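/- arXiv:2010.09835 — 2 statements merged into one kernel-verified Lean document; each statement's English description precedes it below -/
import Mathlib

section
/- Let r ≥ 2, c ≥ 5, q ≥ 1, and g₁,…,g_{c−1} reals with 0 ≤ gᵢ ≤ r, with g_{c−1} = max gᵢ =: Γ and g_{c−2} = min gᵢ =: γ. Define g'ᵢ = gᵢ for i ≤ c−3 and g'_{c−2} = g'_{c−1} = (γ + Γ)/2. Then Σ_{k=0}^{q} M(g'₁,…,g'_{c−1}; k) − Σ_{k=0}^{q} M(g₁,…,g_{c−1}; k) = (g'_{c−2}g'_{c−1} − g_{c−2}g_{c−1}) · (M(g₁,…,g_{c−3}; q) − M(g₁,…,g_{c−3}; q−1)). -/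
open Finset

noncomputable def Msum {s : ℕ} (r : ℝ) (g : Fin s → ℝ) (k : ℕ) : ℝ :=
  ∑ h ∈ univ.filter (fun h : Fin s → Bool =>
      (∀ i, g i = r → h i = true) ∧ (∀ i, g i = 0 → h i = false) ∧
      (univ.filter (fun i => h i = true)).card = k),
    ∏ i, (if h i then g i else r - g i)


open Polynomial in
lemma Msum_eq_coeff {s : ℕ} (r : ℝ) (g : Fin s → ℝ) (k : ℕ) :
    Msum r g k = (∏ i, (C (g i) * X + C (r - g i)) : ℝ[X]).coeff k := by
  have h1 : (∏ i, (C (g i) * X + C (r - g i)) : ℝ[X])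
      = ∑ h : Fin s → Bool, C (∏ i, (if h i then g i else r - g i)) *
          X ^ (univ.filter (fun i => h i = true)).card := by
    have h2 : ∀ i, (C (g i) * X + C (r - g i) : ℝ[X])
        = ∑ b : Bool, (if b then C (g i) * X else C (r - g i)) := by
      intro i; simp
    simp_rw [h2]
    rw [Finset.prod_univ_sum, Fintype.piFinset_univ]
    refine Finset.sum_congr rfl fun h _ => ?_
    rw [map_prod, Finset.card_filter, ← Finset.prod_pow_eq_pow_sum, ← Finset.prod_mul_distrib]
    refine Finset.prod_congr rfl fun i _ => ?_
    cases h i <;> simp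
  rw [h1, finsetSum_coeff, Msum, Finset.sum_filter]
  refine Finset.sum_congr rfl fun h _ => ?_
  rw [coeff_C_mul, coeff_X_pow]
  by_cases hk : (univ.filter (fun i => h i = true)).card = k
  · by_cases ha : ∀ i, g i = r → h i = true
    · by_cases hb : ∀ i, g i = 0 → h i = false
      · rw [if_pos ⟨ha, hb, hk⟩, if_pos hk.symm, mul_one]
      · rw [if_neg (fun h => hb h.2.1)]
        push Not at hb
        obtain ⟨i, hi, hi2⟩ := hb
        rw [Finset.prod_eq_zero (mem_univ i), zero_mul]
        simp_all
    · rw [if_neg (fun h => ha h.1)]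
      push Not at ha
      obtain ⟨i, hi, hi2⟩ := ha
      rw [Finset.prod_eq_zero (mem_univ i), zero_mul]
      simp_all
  · rw [if_neg (fun h => hk h.2.2), if_neg (fun h => hk h.symm), mul_zero]

lemma Msum_succ {n : ℕ} (r : ℝ) (g : Fin (n + 1) → ℝ) (k : ℕ) :
    Msum r g (k + 1) = g (Fin.last n) * Msum r (fun i : Fin n => g i.castSucc) k
      + (r - g (Fin.last n)) * Msum r (fun i : Fin n => g i.castSucc) (k + 1) := by
  simp only [Msum_eq_coeff, Fin.prod_univ_castSucc, mul_add, Polynomial.coeff_add,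
    ← mul_assoc, Polynomial.coeff_mul_X, Polynomial.coeff_mul_C]
  ring

lemma Msum_zero {n : ℕ} (r : ℝ) (g : Fin (n + 1) → ℝ) :
    Msum r g 0 = (r - g (Fin.last n)) * Msum r (fun i : Fin n => g i.castSucc) 0 := by
  simp only [Msum_eq_coeff, Fin.prod_univ_castSucc, mul_add, Polynomial.coeff_add,
    ← mul_assoc, Polynomial.coeff_mul_X_zero, Polynomial.coeff_mul_C]
  ring

lemma Msum_sum {n : ℕ} (r : ℝ) (g : Fin (n + 1) → ℝ) (q : ℕ) :
    ∑ k ∈ Finset.range (q + 1), Msum r g k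
      = r * ∑ k ∈ Finset.range (q + 1), Msum r (fun i : Fin n => g i.castSucc) k
        - g (Fin.last n) * Msum r (fun i : Fin n => g i.castSucc) q := by
  induction q with
  | zero => simp [Msum_zero]; ring
  | succ q ih =>
    rw [Finset.sum_range_succ, ih, Finset.sum_range_succ _ (q + 1), Msum_succ]
    ring

lemma Msum_sum_two {n : ℕ} (r : ℝ) (g : Fin (n + 2) → ℝ) (q : ℕ) (f : Fin n → ℝ) (x y : ℝ)
    (hf : ∀ i : Fin n, g i.castSucc.castSucc = f i) (hx : g (Fin.last n).castSucc = x)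
    (hy : g (Fin.last (n + 1)) = y) :
    ∑ k ∈ Finset.range (q + 2), Msum r g k
      = r ^ 2 * ∑ k ∈ Finset.range (q + 2), Msum r f k
        - r * (x + y) * Msum r f (q + 1) + x * y * (Msum r f (q + 1) - Msum r f q) := by
  rw [Msum_sum, Msum_sum, Msum_succ]
  simp only [hf, hx, hy]
  ring

/-- The smoothing identity in the proof of Theorem 3: replacing the extreme values
`g_{c−2} = γ` and `g_{c−1} = Γ` by their mean `(γ+Γ)/2` changes `Σ_{k=0}^{q} M(·;k)` by
`(g'_{c−2}g'_{c−1} − g_{c−2}g_{c−1})(M(g₁,…,g_{c−3}; q) − M(g₁,…,g_{c−3}; q−1))`. -/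
theorem stmt6 (r : ℝ) (hr : 2 ≤ r) (c : ℕ) (hc : 5 ≤ c) (q : ℕ) (hq : 1 ≤ q)
    (g : Fin (c - 1) → ℝ) (hg : ∀ i, 0 ≤ g i ∧ g i ≤ r) (Γ γ : ℝ)
    (hΓ : g ⟨c - 2, by omega⟩ = Γ) (hΓmax : ∀ i, g i ≤ Γ)
    (hγ : g ⟨c - 3, by omega⟩ = γ) (hγmin : ∀ i, γ ≤ g i) :
    (∑ k ∈ Finset.range (q + 1),
        Msum r (fun i : Fin (c - 1) => if (i : ℕ) < c - 3 then g i else (γ + Γ) / 2) k)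
      - (∑ k ∈ Finset.range (q + 1), Msum r g k)
      = ((γ + Γ) / 2 * ((γ + Γ) / 2) - g ⟨c - 3, by omega⟩ * g ⟨c - 2, by omega⟩)
        * (Msum r (fun i : Fin (c - 3) => g (Fin.castLE (by omega) i)) q
            - Msum r (fun i : Fin (c - 3) => g (Fin.castLE (by omega) i)) (q - 1)) := by
  obtain ⟨n, rfl⟩ : ∃ n, c = n + 3 := ⟨c - 3, by omega⟩
  obtain ⟨p, rfl⟩ : ∃ p, q = p + 1 := ⟨q - 1, by omega⟩
  have e1 := Msum_sum_two (n := n) r g p (fun i => g (Fin.castLE (by omega) i)) γ Γ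
    (fun i => rfl) hγ hΓ
  have e2 := Msum_sum_two (n := n) r
    (fun i : Fin (n + 2) => if (i : ℕ) < n then g i else (γ + Γ) / 2) p
    (fun i => g (Fin.castLE (by omega) i)) ((γ + Γ) / 2) ((γ + Γ) / 2)
    (fun i => by simp; rfl) (by simp) (by simp)
  rw [hγ, hΓ]
  have key : ∀ R S A B : ℝ,
      (R * S - r * ((γ + Γ) / 2 + (γ + Γ) / 2) * A + (γ + Γ) / 2 * ((γ + Γ) / 2) * (A - B))
        - (R * S - r * (γ + Γ) * A + γ * Γ * (A - B))
      = ((γ + Γ) / 2 * ((γ + Γ) / 2) - γ * Γ) * (A - B) := by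
    intros; ring
  exact (congrArg₂ (· - ·) e2 e1).trans (key _ _ _ _)
end

section
/- Let r ≥ 2, c ≥ 5, and let G_{r,c} be a balanced c-partite tournament such that δ(G_{r,c}) ≥ q(r + μ(G_{r,c}))·(c−1)/(c−2) for some q ≥ 0. Then for every vertex x, the number T⁺_q(x) of maximal subtournaments (one vertex per part, containing x) in which x has out-degree at most q satisfies T⁺_q(x) ≤ Σ_{k=0}^{q} C(c−1,k)·(d⁺(x)/(c−1))^k·(d⁻(x)/(c−1))^{c−1−k}. -/
open Finset

/-- A balanced `c`-partite tournament with parts `Vᵢ = {i} × Fin r`: an orientation of the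
complete `c`-partite graph in which every part has exactly `r` vertices. -/
structure BalancedMPT (c r : ℕ) where
  adj : Fin c × Fin r → Fin c × Fin r → Bool
  oriented : ∀ u v, u.1 ≠ v.1 → adj u v = !adj v u
  samePart : ∀ u v, u.1 = v.1 → adj u v = false

namespace BalancedMPT

variable {c r : ℕ}

/-- Out-degree of a vertex. -/
def outDeg (G : BalancedMPT c r) (x : Fin c × Fin r) : ℕ :=
  (univ.filter fun y => G.adj x y = true).card

/-- In-degree of a vertex. -/
def inDeg (G : BalancedMPT c r) (x : Fin c × Fin r) : ℕ :=
  (univ.filter fun y => G.adj y x = true).card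

/-- `d⁺ᵢ(x)`: number of out-neighbours of `x` in the part `Vᵢ`. -/
def outDegIn (G : BalancedMPT c r) (x : Fin c × Fin r) (i : Fin c) : ℕ :=
  (univ.filter fun v : Fin r => G.adj x (i, v) = true).card

/-- `d⁻ᵢ(x)`: number of in-neighbours of `x` in the part `Vᵢ`. -/
def inDegIn (G : BalancedMPT c r) (x : Fin c × Fin r) (i : Fin c) : ℕ :=
  (univ.filter fun v : Fin r => G.adj (i, v) x = true).card

end BalancedMPT

open BalancedMPT

open Finset Polynomial in
/-- generating polynomial -/
noncomputable def gp {ι : Type} (R : ℝ) (s : Finset ι) (a : ι → ℝ) : Polynomial ℝ :=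
  ∏ i ∈ s, (C (R - a i) + C (a i) * X)

/-- cumulative coefficient sum -/
noncomputable def cum (q : ℕ) (P : Polynomial ℝ) : ℝ := ∑ k ∈ Finset.range (q + 1), P.coeff k

open Polynomial in
lemma lin_coeff_succ (u v : ℝ) (Q : Polynomial ℝ) (k : ℕ) :
    ((C u + C v * X) * Q).coeff (k + 1) = u * Q.coeff (k + 1) + v * Q.coeff k := by
  rw [add_mul, mul_assoc, coeff_add, coeff_C_mul, coeff_C_mul, coeff_X_mul]

open Polynomial in
lemma lin_coeff_zero (u v : ℝ) (Q : Polynomial ℝ) :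
    ((C u + C v * X) * Q).coeff 0 = u * Q.coeff 0 := by
  rw [add_mul, mul_assoc, coeff_add, coeff_C_mul, coeff_C_mul, coeff_X_mul_zero]; ring

open Polynomial in
lemma gp_nonneg {ι : Type} [DecidableEq ι] (R : ℝ) (s : Finset ι) (a : ι → ℝ)
    (h0 : ∀ i ∈ s, 0 ≤ a i) (h1 : ∀ i ∈ s, a i ≤ R) (k : ℕ) : 0 ≤ (gp R s a).coeff k := by
  induction s using Finset.induction_on generalizing k with
  | empty => simp only [gp, Finset.prod_empty, coeff_one]; split_ifs <;> norm_num
  | insert i s hi ih =>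
    have ih' := ih (fun j hj => h0 j (Finset.mem_insert_of_mem hj))
      (fun j hj => h1 j (Finset.mem_insert_of_mem hj))
    have e : gp R (insert i s) a = (C (R - a i) + C (a i) * X) * gp R s a := by
      simp only [gp]; rw [Finset.prod_insert hi]
    have p0 := h0 i (Finset.mem_insert_self _ _)
    have p1 := sub_nonneg.2 (h1 i (Finset.mem_insert_self _ _))
    rw [e]
    cases k with
    | zero => rw [lin_coeff_zero]; exact mul_nonneg p1 (ih' _)
    | succ k => 
      rw [lin_coeff_succ]; exact add_nonneg (mul_nonneg p1 (ih' _)) (mul_nonneg p0 (ih' _))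

open Polynomial in
lemma gp_deriv {ι : Type} [DecidableEq ι] (R : ℝ) (s : Finset ι) (a : ι → ℝ) (k : ℕ) :
    (gp R s a).coeff (k + 1) * ((k : ℝ) + 1) = ∑ i ∈ s, a i * (gp R (s.erase i) a).coeff k := by
  rw [← coeff_derivative]
  simp only [gp]
  rw [derivative_prod_finset, finsetSum_coeff]
  refine Finset.sum_congr rfl fun i _ => ?_
  have : derivative (C (R - a i) + C (a i) * X) = C (a i) := by simp
  rw [this, coeff_mul_C, mul_comm]

open Polynomial in
lemma gp_erase {ι : Type} [DecidableEq ι] (R : ℝ) (s : Finset ι) (a : ι → ℝ) (i : ι) (hi : i ∈ s) :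
    gp R s a = (C (R - a i) + C (a i) * X) * gp R (s.erase i) a := by
  simp only [gp]; rw [Finset.mul_prod_erase s (fun i => C (R - a i) + C (a i) * X) hi]

lemma gp_mono {ι : Type} [DecidableEq ι] (R H : ℝ) (hH : 0 < H) (s : Finset ι) (a : ι → ℝ)
    (h0 : ∀ i ∈ s, 0 ≤ a i) (h1 : ∀ i ∈ s, a i ≤ R) (h2 : ∀ i ∈ s, a i ≤ H)
    (h3 : ∀ i ∈ s, R - a i ≤ H) (k : ℕ)
    (hs : (2 * ((k : ℝ) + 1) - 1) * H ≤ ∑ i ∈ s, a i) :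
    (gp R s a).coeff k ≤ (gp R s a).coeff (k + 1) := by
  have nn : ∀ i j, 0 ≤ (gp R (s.erase i) a).coeff j := fun i j =>
    gp_nonneg R _ a (fun j hj => h0 j (Finset.mem_of_mem_erase hj))
      (fun j hj => h1 j (Finset.mem_of_mem_erase hj)) j
  have nE := gp_nonneg R s a h0 h1 k
  have d1 := gp_deriv R s a k
  have key : (∑ i ∈ s, a i - H * k) * (gp R s a).coeff k
      ≤ H * ((gp R s a).coeff (k + 1) * ((k : ℝ) + 1)) := by
    rw [d1, Finset.mul_sum]
    cases k with
    | zero =>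
      simp only [Nat.cast_zero, mul_zero, sub_zero]
      rw [Finset.sum_mul]
      refine Finset.sum_le_sum fun i hi => ?_
      rw [gp_erase R s a i hi, lin_coeff_zero]
      nlinarith [mul_nonneg (mul_nonneg (h0 i hi) (nn i 0)) (sub_nonneg.2 (h3 i hi))]
    | succ k =>
      have d0 := gp_deriv R s a k
      have : H * ((k + 1 : ℕ) : ℝ) * (gp R s a).coeff (k + 1)
          = ∑ i ∈ s, H * (a i * (gp R (s.erase i) a).coeff k) := by
        rw [← Finset.mul_sum, ← d0]; push_cast; ring
      rw [sub_mul, this, Finset.sum_mul, ← Finset.sum_sub_distrib]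
      refine Finset.sum_le_sum fun i hi => ?_
      rw [gp_erase R s a i hi, lin_coeff_succ]
      nlinarith [mul_nonneg (mul_nonneg (h0 i hi) (nn i (k+1))) (sub_nonneg.2 (h3 i hi)),
        mul_nonneg (mul_nonneg (h0 i hi) (nn i k)) (sub_nonneg.2 (h2 i hi))]
  have k2 : (H * (k + 1)) * (gp R s a).coeff k ≤ (∑ i ∈ s, a i - H * k) * (gp R s a).coeff k :=
    mul_le_mul_of_nonneg_right (by linarith) nE
  have hp : 0 < H * ((k : ℝ) + 1) := by positivity
  refine le_of_mul_le_mul_left ?_ hp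
  linarith

open Polynomial in
lemma cum_one_sub (q : ℕ) (Q : Polynomial ℝ) : cum q ((1 - X) * Q) = Q.coeff q := by
  have e : (1 - X : Polynomial ℝ) = C 1 + C (-1) * X := by simp [sub_eq_add_neg]
  rw [e]
  induction q with
  | zero => simp only [cum, zero_add, Finset.sum_range_one, lin_coeff_zero, one_mul]
  | succ q ih =>
    unfold cum at *
    rw [Finset.sum_range_succ, ih, lin_coeff_succ]; ring

lemma cum_add (q : ℕ) (P Q : Polynomial ℝ) : cum q (P + Q) = cum q P + cum q Q := by
  simp [cum, Finset.sum_add_distrib]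

open Polynomial in
lemma cum_C_mul (q : ℕ) (d : ℝ) (Q : Polynomial ℝ) : cum q (C d * Q) = d * cum q Q := by
  simp [cum, Finset.mul_sum]

open Polynomial in
lemma gp_main {ι : Type} [DecidableEq ι] (R H m : ℝ) (hH : 0 < H) (s : Finset ι) (q : ℕ)
    (hm : 2 * q * H ≤ ((s.card : ℝ) - 1) * m) (N : ℕ) : ∀ (a : ι → ℝ)
    (_ : (s.filter fun i => a i ≠ m).card ≤ N)
    (_ : ∀ i ∈ s, 0 ≤ a i) (_ : ∀ i ∈ s, a i ≤ R) (_ : ∀ i ∈ s, a i ≤ H)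
    (_ : ∀ i ∈ s, R - a i ≤ H) (_ : ∑ i ∈ s, a i = s.card * m),
    cum q (gp R s a) ≤ cum q ((C (R - m) + C m * X) ^ s.card) := by
  induction N with
  | zero =>
    intro a hN h0 h1 h2 h3 hs
    have : ∀ i ∈ s, a i = m := by
      have := Finset.card_eq_zero.1 (Nat.le_zero.1 hN)
      rw [Finset.filter_eq_empty_iff] at this
      intro i hi; simpa using this hi
    apply le_of_eq
    congr 1
    unfold gp
    rw [← Finset.prod_const]
    exact Finset.prod_congr rfl fun i hi => by rw [this i hi]
  | succ N ih =>
    intro a hN h0 h1 h2 h3 hs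
    by_cases hall : ∀ i ∈ s, a i = m
    · apply le_of_eq
      congr 1
      unfold gp
      rw [← Finset.prod_const]
      exact Finset.prod_congr rfl fun i hi => by rw [hall i hi]
    have hs' : ∑ i ∈ s, a i = ∑ i ∈ s, m := by rw [hs]; simp
    obtain ⟨l, hl, hlm⟩ : ∃ i ∈ s, a i < m := by
      by_contra! hc
      exact hall fun i hi => ((Finset.sum_eq_sum_iff_of_le hc).1 hs'.symm i hi).symm
    obtain ⟨j, hj, hjm⟩ : ∃ i ∈ s, m < a i := by
      by_contra! hc
      exact hall fun i hi => ((Finset.sum_eq_sum_iff_of_le hc).1 hs' i hi)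
    have hlj : l ≠ j := by rintro rfl; linarith
    have hj' : j ∈ s.erase l := Finset.mem_erase.2 ⟨hlj.symm, hj⟩
    let b : ι → ℝ := fun i => if i = l then m else if i = j then a l + a j - m else a i
    have bl : b l = m := by simp [b]
    have bj : b j = a l + a j - m := by simp [b, hlj.symm]
    have bo : ∀ i, i ≠ l → i ≠ j → b i = a i := fun i x y => by simp [b, x, y]
    set t := (s.erase l).erase j with ht
    have bt : ∀ i ∈ t, b i = a i := fun i hi => by
      simp only [ht, Finset.mem_erase] at hi
      exact bo i hi.2.1 hi.1
    have tsub : ∀ i ∈ t, i ∈ s := fun i hi => by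
      simp only [ht, Finset.mem_erase] at hi; exact hi.2.2
    have sumsplit : ∀ f : ι → ℝ, ∑ i ∈ s, f i = f l + (f j + ∑ i ∈ t, f i) := fun f => by
      rw [ht, Finset.add_sum_erase _ f hj', Finset.add_sum_erase _ f hl]
    have bb : ∀ i ∈ s, (b i = a i ∨ (a l ≤ b i ∧ b i ≤ a j)) := fun i hi => by
      by_cases e1 : i = l
      · subst e1; right; rw [bl]; constructor <;> linarith
      by_cases e2 : i = j
      · subst e2; right; rw [bj]; constructor <;> linarith
      left; exact bo i e1 e2
    have step : cum q (gp R s a) ≤ cum q (gp R s b) := by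
      have gt : gp R t b = gp R t a := by
        unfold gp; exact Finset.prod_congr rfl fun i hi => by rw [bt i hi]
      have ea : gp R s a = (C (R - a l) + C (a l) * X) * ((C (R - a j) + C (a j) * X) * gp R t a) := by
        rw [gp_erase R s a l hl, gp_erase R _ a j hj']
      have eb : gp R s b = (C (R - m) + C m * X) *
          ((C (R - (a l + a j - m)) + C (a l + a j - m) * X) * gp R t a) := by
        rw [gp_erase R s b l hl, gp_erase R _ b j hj', bl, bj, ← ht, gt]
      have ed : gp R s b = gp R s a
          + C (m * (a l + a j - m) - a l * a j) * ((1 - X) * ((1 - X) * gp R t a)) := by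
        rw [ea, eb]; simp only [map_sub, map_add, map_mul]; ring
      rw [ed, cum_add, cum_C_mul, cum_one_sub]
      have hd : 0 ≤ m * (a l + a j - m) - a l * a j := by nlinarith
      have hc : 0 ≤ ((1 - X) * gp R t a).coeff q := by
        have e : (1 - X : Polynomial ℝ) = C 1 + C (-1) * X := by simp [sub_eq_add_neg]
        rw [e]
        cases q with
        | zero =>
          rw [lin_coeff_zero, one_mul]
          exact gp_nonneg R t a (fun i hi => h0 i (tsub i hi)) (fun i hi => h1 i (tsub i hi)) 0
        | succ k =>
          rw [lin_coeff_succ]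
          have := gp_mono R H hH t a (fun i hi => h0 i (tsub i hi)) (fun i hi => h1 i (tsub i hi))
            (fun i hi => h2 i (tsub i hi)) (fun i hi => h3 i (tsub i hi)) k (by
              have := sumsplit a
              have := h2 j hj
              push_cast at hm
              linarith)
          linarith
      have := mul_nonneg hd hc
      linarith
    refine step.trans (ih b ?_ ?_ ?_ ?_ ?_ ?_)
    · have : (s.filter fun i => b i ≠ m) ⊂ (s.filter fun i => a i ≠ m) := by
        rw [Finset.ssubset_iff_of_subset]
        · exact ⟨l, by simp [hl, hlm.ne], by simp [bl]⟩
        · intro i hi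
          rw [Finset.mem_filter] at hi ⊢
          refine ⟨hi.1, ?_⟩
          by_cases e1 : i = l
          · subst e1; exact absurd bl hi.2
          by_cases e2 : i = j
          · subst e2; exact hjm.ne'
          rw [← bo i e1 e2]; exact hi.2
      have := Finset.card_lt_card this
      omega
    · intro i hi
      rcases bb i hi with h | h
      · rw [h]; exact h0 i hi
      · linarith [h0 l hl]
    · intro i hi
      rcases bb i hi with h | h
      · rw [h]; exact h1 i hi
      · linarith [h1 j hj]
    · intro i hi
      rcases bb i hi with h | h
      · rw [h]; exact h2 i hi
      · linarith [h2 j hj]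
    · intro i hi
      rcases bb i hi with h | h
      · rw [h]; exact h3 i hi
      · linarith [h3 l hl]
    · rw [← hs, sumsplit a, sumsplit b, bl, bj, Finset.sum_congr rfl bt]; ring

open Polynomial in
lemma cum_pow (q n : ℕ) (u v : ℝ) : cum q ((C u + C v * X) ^ n)
    = ∑ k ∈ Finset.range (q + 1), (n.choose k : ℝ) * v ^ k * u ^ (n - k) := by
  unfold cum
  refine Finset.sum_congr rfl fun k _ => ?_
  rw [add_comm, add_pow, finsetSum_coeff]
  have : ∀ i, ((C v * X) ^ i * (C u) ^ (n - i) * (n.choose i : Polynomial ℝ)).coeff k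
      = if k = i then (n.choose i : ℝ) * v ^ i * u ^ (n - i) else 0 := fun i => by
    have e : ((C v * X) ^ i * (C u) ^ (n - i) * (n.choose i : Polynomial ℝ))
        = C ((n.choose i : ℝ) * v ^ i * u ^ (n - i)) * X ^ i := by
      simp only [map_mul, map_pow, map_natCast]; ring
    rw [e, coeff_C_mul_X_pow]
  simp only [this]
  rw [Finset.sum_ite_eq]
  split_ifs with h
  · rfl
  · have : n < k := by simpa using h
    rw [Nat.choose_eq_zero_of_lt this]; simp

lemma out_add_in {c r : ℕ} (G : BalancedMPT c r) (x : Fin c × Fin r) (i : Fin c) (hi : i ≠ x.1) :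
    G.outDegIn x i + G.inDegIn x i = r := by
  unfold BalancedMPT.outDegIn BalancedMPT.inDegIn
  have : (univ.filter fun v : Fin r => G.adj (i, v) x = true)
      = univ.filter fun v : Fin r => ¬ G.adj x (i, v) = true := by
    ext v
    have := G.oriented x (i, v) (fun h => hi h.symm)
    simp [this]
  rw [this, Finset.card_filter_add_card_filter_not]
  simp

lemma outDeg_sum {c r : ℕ} (G : BalancedMPT c r) (x : Fin c × Fin r) :
    G.outDeg x = ∑ i ∈ univ.erase x.1, G.outDegIn x i := by
  have h0 : G.outDegIn x x.1 = 0 := by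
    simp [BalancedMPT.outDegIn, fun v => G.samePart x (x.1, v) rfl]
  rw [← zero_add (∑ i ∈ univ.erase x.1, G.outDegIn x i), ← h0,
    Finset.add_sum_erase _ _ (Finset.mem_univ _)]
  simp only [BalancedMPT.outDeg, BalancedMPT.outDegIn, Finset.card_filter]
  rw [Fintype.sum_prod_type]

lemma inDeg_sum {c r : ℕ} (G : BalancedMPT c r) (x : Fin c × Fin r) :
    G.inDeg x = ∑ i ∈ univ.erase x.1, G.inDegIn x i := by
  have h0 : G.inDegIn x x.1 = 0 := by
    simp [BalancedMPT.inDegIn, fun v => G.samePart (x.1, v) x rfl]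
  rw [← zero_add (∑ i ∈ univ.erase x.1, G.inDegIn x i), ← h0,
    Finset.add_sum_erase _ _ (Finset.mem_univ _)]
  simp only [BalancedMPT.inDeg, BalancedMPT.inDegIn, Finset.card_filter]
  rw [Fintype.sum_prod_type]

open Polynomial in
lemma count_eq {c r : ℕ} (G : BalancedMPT c r) (x : Fin c × Fin r) (q : ℕ) :
    (((univ.filter fun f : Fin c → Fin r =>
          f x.1 = x.2 ∧ (univ.filter fun i => G.adj x (i, f i) = true).card ≤ q).card : ℕ) : ℝ)
      = cum q (gp (r : ℝ) (univ.erase x.1) fun i => (G.outDegIn x i : ℝ)) := by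
  let t : Fin c → Finset (Fin r) := fun i => if i = x.1 then {x.2} else univ
  let g : Fin c → Fin r → Polynomial ℝ := fun i v => if G.adj x (i, v) = true then X else 1
  have hp := Finset.prod_univ_sum t g
  have e1 : ∏ i, ∑ v ∈ t i, g i v = gp (r : ℝ) (univ.erase x.1) fun i => (G.outDegIn x i : ℝ) := by
    rw [← Finset.mul_prod_erase univ _ (Finset.mem_univ x.1)]
    have : ∑ v ∈ t x.1, g x.1 v = 1 := by
      simp [t, g, G.samePart x (x.1, _) rfl]
    rw [this, one_mul]
    unfold gp
    refine Finset.prod_congr rfl fun i hi => ?_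
    have hi' : i ≠ x.1 := Finset.ne_of_mem_erase hi
    have ti : t i = univ := by simp [t, hi']
    rw [ti]
    simp only [g]
    have hc := Finset.card_filter_add_card_filter_not (s := (univ : Finset (Fin r)))
      (fun v => G.adj x (i, v) = true)
    rw [Finset.card_univ, Fintype.card_fin] at hc
    have hc' : (r : ℝ) - (G.outDegIn x i : ℝ)
        = ((univ.filter fun v : Fin r => ¬ G.adj x (i, v) = true).card : ℝ) := by
      unfold BalancedMPT.outDegIn
      rw [sub_eq_iff_eq_add]
      exact_mod_cast (by omega)
    rw [hc', Finset.sum_ite, Finset.sum_const, Finset.sum_const]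
    unfold BalancedMPT.outDegIn
    simp only [nsmul_eq_mul, map_natCast, mul_one]
    ring
  rw [← e1, hp]
  have e2 : ∀ f : Fin c → Fin r, ∏ i, g i (f i)
      = X ^ (univ.filter fun i => G.adj x (i, f i) = true).card := fun f => by
    simp only [g]
    rw [Finset.prod_ite, Finset.prod_const, Finset.prod_const_one, mul_one]
  simp only [e2]
  have e3 : Fintype.piFinset t = univ.filter fun f : Fin c → Fin r => f x.1 = x.2 := by
    ext f
    simp only [Fintype.mem_piFinset, Finset.mem_filter, Finset.mem_univ, true_and, t]
    constructor
    · intro h; simpa using h x.1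
    · intro h i
      by_cases hi : i = x.1
      · subst hi; simp [h]
      · simp [hi]
  rw [e3]
  unfold cum
  simp only [finsetSum_coeff, coeff_X_pow]
  rw [Finset.sum_comm]
  simp only [Finset.sum_ite_eq', Finset.mem_range, Nat.lt_succ_iff]
  rw [← Finset.filter_filter, Finset.card_filter]
  push_cast
  rfl

/-- Theorem 3 of the paper: if `δ(G) ≥ q(r + μ(G))(c−1)/(c−2)` then for every vertex `x`,
the number `T⁺_q(x)` of maximal subtournaments containing `x` in which `x` has out-degree at
most `q` satisfies `T⁺_q(x) ≤ Σ_{k=0}^{q} C(c−1,k)(d⁺(x)/(c−1))^k (d⁻(x)/(c−1))^{c−1−k}`. -/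
theorem stmt18 (c r : ℕ) (hr : 2 ≤ r) (hc : 5 ≤ c) (G : BalancedMPT c r) (q : ℕ)
    (hδ : ((sInf (Set.range fun x : Fin c × Fin r => min (G.outDeg x) (G.inDeg x)) : ℕ) : ℝ)
      ≥ (q : ℝ) * ((r : ℝ) +
          (((univ : Finset (Fin c × Fin r)).sup fun x =>
            ((univ : Finset (Fin c)).erase x.1).sup fun i =>
              max (G.outDegIn x i - G.inDegIn x i) (G.inDegIn x i - G.outDegIn x i) : ℕ) : ℝ))
        * (((c : ℝ) - 1) / ((c : ℝ) - 2))) :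
    ∀ x : Fin c × Fin r,
      (((univ.filter fun f : Fin c → Fin r =>
          f x.1 = x.2 ∧ (univ.filter fun i => G.adj x (i, f i) = true).card ≤ q).card : ℕ) : ℝ)
        ≤ ∑ k ∈ Finset.range (q + 1),
            (Nat.choose (c - 1) k : ℝ) * ((G.outDeg x : ℝ) / ((c : ℝ) - 1)) ^ k
              * ((G.inDeg x : ℝ) / ((c : ℝ) - 1)) ^ (c - 1 - k) := by
  intro x
  set μ := ((univ : Finset (Fin c × Fin r)).sup fun x =>
            ((univ : Finset (Fin c)).erase x.1).sup fun i =>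
              max (G.outDegIn x i - G.inDegIn x i) (G.inDegIn x i - G.outDegIn x i)) with hμ
  have hbound : ∀ i, i ≠ x.1 →
      max (G.outDegIn x i - G.inDegIn x i) (G.inDegIn x i - G.outDegIn x i) ≤ μ := by
    intro i hi
    refine le_trans ?_ (Finset.le_sup (f := fun x : Fin c × Fin r =>
      ((univ : Finset (Fin c)).erase x.1).sup fun i =>
        max (G.outDegIn x i - G.inDegIn x i) (G.inDegIn x i - G.outDegIn x i))
        (Finset.mem_univ x))
    exact Finset.le_sup (f := fun i => max (G.outDegIn x i - G.inDegIn x i)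
      (G.inDegIn x i - G.outDegIn x i)) (Finset.mem_erase.2 ⟨hi, Finset.mem_univ i⟩)
  have hmin : sInf (Set.range fun x : Fin c × Fin r => min (G.outDeg x) (G.inDeg x))
      ≤ G.outDeg x := le_trans (Nat.sInf_le ⟨x, rfl⟩) (min_le_left _ _)
  have hcR : (5 : ℝ) ≤ c := by exact_mod_cast hc
  have hrR : (2 : ℝ) ≤ r := by exact_mod_cast hr
  have hcard : ((univ : Finset (Fin c)).erase x.1).card = c - 1 := by
    rw [Finset.card_erase_of_mem (Finset.mem_univ _)]; simp
  have hcc : ((c - 1 : ℕ) : ℝ) = (c : ℝ) - 1 := by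
    rw [Nat.cast_sub (by omega)]; simp
  have hH : (0 : ℝ) < ((r : ℝ) + μ) / 2 := by positivity
  have hin : (r : ℝ) - (G.outDeg x : ℝ) / ((c : ℝ) - 1) = (G.inDeg x : ℝ) / ((c : ℝ) - 1) := by
    have : G.outDeg x + G.inDeg x = (c - 1) * r := by
      rw [outDeg_sum, inDeg_sum, ← Finset.sum_add_distrib,
        Finset.sum_congr rfl fun i hi => out_add_in G x i (Finset.ne_of_mem_erase hi)]
      simp [hcard]
    have h2 : (G.outDeg x : ℝ) + G.inDeg x = ((c : ℝ) - 1) * r := by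
      rw [← hcc]; exact_mod_cast this
    have : (c : ℝ) - 1 ≠ 0 := by linarith
    field_simp
    linarith
  have hd : (q : ℝ) * ((r : ℝ) + μ) * (((c : ℝ) - 1) / ((c : ℝ) - 2)) ≤ G.outDeg x :=
    le_trans hδ (by exact_mod_cast hmin)
  have hb : ∀ i ∈ (univ : Finset (Fin c)).erase x.1,
      (G.outDegIn x i : ℝ) ≤ r ∧ (G.outDegIn x i : ℝ) ≤ ((r : ℝ) + μ) / 2
        ∧ (r : ℝ) - (G.outDegIn x i : ℝ) ≤ ((r : ℝ) + μ) / 2 := by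
    intro i hi
    have h1 := out_add_in G x i (Finset.ne_of_mem_erase hi)
    have h2 := hbound i (Finset.ne_of_mem_erase hi)
    have h3 : G.outDegIn x i ≤ r := by omega
    have h4 : 2 * G.outDegIn x i ≤ r + μ := by omega
    have h5 : r ≤ 2 * G.outDegIn x i + μ := by omega
    have h3' : (G.outDegIn x i : ℝ) ≤ r := by exact_mod_cast h3
    have h4' : 2 * (G.outDegIn x i : ℝ) ≤ r + μ := by exact_mod_cast h4
    have h5' : (r : ℝ) ≤ 2 * (G.outDegIn x i : ℝ) + μ := by exact_mod_cast h5
    refine ⟨h3', ?_, ?_⟩ <;> linarith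
  have main := gp_main (r : ℝ) (((r : ℝ) + μ) / 2) ((G.outDeg x : ℝ) / ((c : ℝ) - 1)) hH
    ((univ : Finset (Fin c)).erase x.1) q (by
      rw [hcard, hcc]
      have p1 : (0 : ℝ) < (c : ℝ) - 1 := by linarith
      have p2 : (0 : ℝ) < (c : ℝ) - 2 := by linarith
      rw [← mul_div_assoc, div_le_iff₀ p2] at hd
      rw [← mul_div_assoc ((c : ℝ) - 1 - 1), le_div_iff₀ p1]
      linarith) _ (fun i => (G.outDegIn x i : ℝ)) le_rfl (fun i _ => Nat.cast_nonneg _)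
    (fun i hi => (hb i hi).1) (fun i hi => (hb i hi).2.1) (fun i hi => (hb i hi).2.2) (by
      rw [hcard, hcc, mul_div_cancel₀ _ (by linarith : (c : ℝ) - 1 ≠ 0), outDeg_sum]
      push_cast; rfl)
  rw [count_eq]
  refine main.trans (le_of_eq ?_)
  rw [hin, hcard, cum_pow]
end
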